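/- Assume (H), g strictly increasing, χ₀(·;c) has two distinct positive real zeros λ₁ < λ₂, and φ is a strictly increasing wavefront with speed c with inf_{z ≤ b} φ'(z)/η₁(z) > 0 (where η₁(z) = min{e^{λ₁z},1} and b > 0 satisfies φ(b−ch) = κ − δ*/2 for constants q*, q_*, δ*, γ* realizing (gg1)–(gg)). Then for every ε > 0 there exists ς(ε) > 0 such that for every nonnegative bounded initial datum w₀ with |φ(·) − w₀(s,·)|_{λ₁} < ς(ε) for all s ∈ [−h,0], every classical solution w of (E1) with initial datum w₀ satisfies |φ(·) − w(t,·)|_{λ₁} < ε for all t ≥ 0. -/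

import Mathlib

open Set Filter

noncomputable section

/-- The weight function `η_λ(t) = min{e^{λt}, 1}`. -/
def eta (lam t : ℝ) : ℝ := min (Real.exp (lam * t)) 1

/-- The characteristic function `χ₀(λ) = λ² − cλ − 1 + g0·e^{−λch}` (with `g0 = g'(0)`). -/
def chi (g0 c h lam : ℝ) : ℝ := lam ^ 2 - c * lam - 1 + g0 * Real.exp (-(lam * c * h))

/-- Hypothesis (H) on the birth function `g` (extended linearly and C¹-smoothly to `(−∞,0]`). -/
structure HypH (g : ℝ → ℝ) (kap del0 Lg : ℝ) : Prop where
  cont : Continuous g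
  nonneg : ∀ x : ℝ, 0 ≤ x → 0 ≤ g x
  kap_pos : 0 < kap
  del0_pos : 0 < del0
  fixed_points : ∀ x : ℝ, 0 ≤ x → (g x = x ↔ x = 0 ∨ x = kap)
  smooth0 : ContDiffOn ℝ 1 g (Set.Ioo (-del0) del0)
  smooth_kap : ContDiffOn ℝ 1 g (Set.Ioo (kap - del0) (kap + del0))
  deriv0_gt : 1 < deriv g 0
  deriv_kap_lt : deriv g kap < 1
  lipschitz : ∀ u v : ℝ, 0 ≤ u → 0 ≤ v → |g u - g v| ≤ Lg * |u - v|
  holder : ∃ C > (0:ℝ), ∃ θ ∈ Set.Ioc (0:ℝ) 1,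
      ∀ u ∈ Set.Ioc (0:ℝ) del0, |deriv g u - deriv g 0| ≤ C * u ^ θ
  ext_linear : ∀ x : ℝ, x ≤ 0 → g x = deriv g 0 * x

/-- (IC1): `0 ≤ w₀ ≤ sup w₀ < ∞` on `Π₀ = [−h,0]×ℝ`. -/
def IC1 (h : ℝ) (w0 : ℝ → ℝ → ℝ) : Prop :=
  ∃ M : ℝ, ∀ s ∈ Set.Icc (-h) 0, ∀ x : ℝ, 0 ≤ w0 s x ∧ w0 s x ≤ M

/-- (IC2): `liminf_{x→+∞} min_{s∈[−h,0]} w₀(s,x) > 0`. -/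
def IC2 (h : ℝ) (w0 : ℝ → ℝ → ℝ) : Prop :=
  ∃ m > (0:ℝ), ∃ X : ℝ, ∀ x ≥ X, ∀ s ∈ Set.Icc (-h) 0, m ≤ w0 s x

/-- `w₀` is locally Hölder continuous in `x`, uniformly in `s ∈ [−h,0]`. -/
def LocHolder (h : ℝ) (w0 : ℝ → ℝ → ℝ) : Prop :=
  ∀ R > (0:ℝ), ∃ K > (0:ℝ), ∃ β ∈ Set.Ioc (0:ℝ) 1,
    ∀ s ∈ Set.Icc (-h) 0, ∀ x ∈ Set.Icc (-R) R, ∀ y ∈ Set.Icc (-R) R,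
      |w0 s x - w0 s y| ≤ K * |x - y| ^ β

/-- A classical solution of the equation (*):
`u_t(t,x) = u_{xx}(t,x) − u(t,x) + g(u(t−h,x))` for `t > 0`, `x ∈ ℝ`. -/
def SolvesStar (g : ℝ → ℝ) (h : ℝ) (u : ℝ → ℝ → ℝ) : Prop :=
  ContinuousOn (fun p : ℝ × ℝ => u p.1 p.2) {p : ℝ × ℝ | -h ≤ p.1} ∧
  (∀ T : ℝ, ∃ M : ℝ, ∀ t ∈ Set.Icc (-h) T, ∀ x : ℝ, |u t x| ≤ M) ∧
  (∀ t : ℝ, 0 < t → ∀ x : ℝ,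
      DifferentiableAt ℝ (fun τ => u τ x) t ∧
      DifferentiableAt ℝ (fun y => u t y) x ∧
      DifferentiableAt ℝ (deriv (fun y => u t y)) x ∧
      deriv (fun τ => u τ x) t =
        deriv (deriv (fun y => u t y)) x - u t x + g (u (t - h) x)) ∧
  ContinuousOn (fun p : ℝ × ℝ => deriv (fun τ => u τ p.2) p.1) {p : ℝ × ℝ | 0 < p.1} ∧
  ContinuousOn (fun p : ℝ × ℝ => deriv (fun y => u p.1 y) p.2) {p : ℝ × ℝ | 0 < p.1} ∧
  ContinuousOn (fun p : ℝ × ℝ => deriv (deriv (fun y => u p.1 y)) p.2) {p : ℝ × ℝ | 0 < p.1}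

/-- A classical solution of equation (E1):
`w_t = w_{zz} − c w_z − w + g(w(t−h, z−ch))` for `t > 0`, `z ∈ ℝ`. -/
def SolvesE1 (g : ℝ → ℝ) (h c : ℝ) (w : ℝ → ℝ → ℝ) : Prop :=
  ContinuousOn (fun p : ℝ × ℝ => w p.1 p.2) {p : ℝ × ℝ | -h ≤ p.1} ∧
  (∀ T : ℝ, ∃ M : ℝ, ∀ t ∈ Set.Icc (-h) T, ∀ z : ℝ, |w t z| ≤ M) ∧
  (∀ t : ℝ, 0 < t → ∀ z : ℝ,
      DifferentiableAt ℝ (fun τ => w τ z) t ∧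
      DifferentiableAt ℝ (fun y => w t y) z ∧
      DifferentiableAt ℝ (deriv (fun y => w t y)) z ∧
      deriv (fun τ => w τ z) t =
        deriv (deriv (fun y => w t y)) z - c * deriv (fun y => w t y) z
          - w t z + g (w (t - h) (z - c * h))) ∧
  ContinuousOn (fun p : ℝ × ℝ => deriv (fun τ => w τ p.2) p.1) {p : ℝ × ℝ | 0 < p.1} ∧
  ContinuousOn (fun p : ℝ × ℝ => deriv (fun y => w p.1 y) p.2) {p : ℝ × ℝ | 0 < p.1} ∧
  ContinuousOn (fun p : ℝ × ℝ => deriv (deriv (fun y => w p.1 y)) p.2) {p : ℝ × ℝ | 0 < p.1}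

/-- A wavefront with speed `c`: a positive bounded C² solution of the profile equation
with `φ(−∞) = 0`, `φ(+∞) = κ`. -/
def IsWavefront (g : ℝ → ℝ) (h c kap : ℝ) (φ : ℝ → ℝ) : Prop :=
  (∀ z : ℝ, 0 < φ z) ∧ (∃ M : ℝ, ∀ z : ℝ, φ z ≤ M) ∧ ContDiff ℝ 2 φ ∧
  (∀ z : ℝ, deriv (deriv φ) z - c * deriv φ z - φ z + g (φ (z - c * h)) = 0) ∧
  Filter.Tendsto φ Filter.atBot (nhds 0) ∧ Filter.Tendsto φ Filter.atTop (nhds kap)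

/-- A semi-wavefront with speed `c`: as a wavefront, but at `+∞` only
`liminf_{z→+∞} φ(z) > 0` is required. -/
def IsSemiWavefront (g : ℝ → ℝ) (h c : ℝ) (φ : ℝ → ℝ) : Prop :=
  (∀ z : ℝ, 0 < φ z) ∧ (∃ M : ℝ, ∀ z : ℝ, φ z ≤ M) ∧ ContDiff ℝ 2 φ ∧
  (∀ z : ℝ, deriv (deriv φ) z - c * deriv φ z - φ z + g (φ (z - c * h)) = 0) ∧
  Filter.Tendsto φ Filter.atBot (nhds 0) ∧
  (∃ m > (0:ℝ), ∀ᶠ z in Filter.atTop, m ≤ φ z)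

/-- The nonlinear operator `𝒩` associated with (E1). -/
def Nop (g : ℝ → ℝ) (h c : ℝ) (w : ℝ → ℝ → ℝ) (t z : ℝ) : ℝ :=
  deriv (fun τ => w τ z) t - deriv (deriv (fun y => w t y)) z
    + c * deriv (fun y => w t y) z + w t z - g (w (t - h) (z - c * h))

/-- A super-solution of (E1) with break point `zs`. -/
def IsSuperSolution (g : ℝ → ℝ) (h c : ℝ) (w : ℝ → ℝ → ℝ) (zs : ℝ) : Prop :=
  ContinuousOn (fun p : ℝ × ℝ => w p.1 p.2) {p : ℝ × ℝ | -h ≤ p.1} ∧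
  (∀ t : ℝ, -h < t → ∀ z : ℝ, DifferentiableAt ℝ (fun τ => w τ z) t) ∧
  (∀ t : ℝ, -h ≤ t → ∀ z : ℝ, z ≠ zs →
      DifferentiableAt ℝ (fun y => w t y) z ∧
      DifferentiableAt ℝ (deriv (fun y => w t y)) z) ∧
  (∀ t : ℝ, 0 < t → ∀ z : ℝ, z ≠ zs → 0 ≤ Nop g h c w t z) ∧
  (∀ t : ℝ, 0 < t →
      derivWithin (fun y => w t y) (Set.Iic zs) zs
        > derivWithin (fun y => w t y) (Set.Ici zs) zs)

/-- A sub-solution of (E1) with break point `zs` (all inequalities reversed). -/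
def IsSubSolution (g : ℝ → ℝ) (h c : ℝ) (w : ℝ → ℝ → ℝ) (zs : ℝ) : Prop :=
  ContinuousOn (fun p : ℝ × ℝ => w p.1 p.2) {p : ℝ × ℝ | -h ≤ p.1} ∧
  (∀ t : ℝ, -h < t → ∀ z : ℝ, DifferentiableAt ℝ (fun τ => w τ z) t) ∧
  (∀ t : ℝ, -h ≤ t → ∀ z : ℝ, z ≠ zs →
      DifferentiableAt ℝ (fun y => w t y) z ∧
      DifferentiableAt ℝ (deriv (fun y => w t y)) z) ∧
  (∀ t : ℝ, 0 < t → ∀ z : ℝ, z ≠ zs → Nop g h c w t z ≤ 0) ∧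
  (∀ t : ℝ, 0 < t →
      derivWithin (fun y => w t y) (Set.Iic zs) zs
        < derivWithin (fun y => w t y) (Set.Ici zs) zs)

/-- Inequality (gg1). -/
def GG1 (g : ℝ → ℝ) (kap h dstar qlow gstar : ℝ) : Prop :=
  ∀ u ∈ Set.Icc (kap - dstar) kap, ∀ q ∈ Set.Icc (0:ℝ) qlow,
    ∀ γ ∈ Set.Icc (0:ℝ) gstar,
      g u - g (u - q * Real.exp (γ * h)) ≤ q * (1 - 2 * γ)

/-- Inequality (gg). -/
def GG2 (g : ℝ → ℝ) (kap h dstar qstar gstar : ℝ) : Prop :=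
  ∀ u ∈ Set.Icc (kap - dstar) kap, ∀ q ∈ Set.Icc (0:ℝ) qstar,
    ∀ γ ∈ Set.Icc (0:ℝ) gstar,
      -(q * (1 - 2 * γ)) ≤ g u - g (u + q * Real.exp (γ * h))

theorem second_deriv_nonneg_of_isLocalMin {f f' : ℝ → ℝ} {f'' z : ℝ}
    (hf : ∀ y, HasDerivAt f (f' y) y) (hf' : HasDerivAt f' f'' z) (hmin : IsLocalMin f z) :
    0 ≤ f'' := by
  by_contra! hneg
  have hderiv : deriv f = f' := funext fun y => (hf y).deriv
  have hmax : IsLocalMax f z :=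
    isLocalMax_of_deriv_deriv_neg (by rwa [hderiv, hf'.deriv]) hmin.deriv_eq_zero
      (hf z).continuousAt
  have hconst : f =ᶠ[nhds z] fun _ => f z := by
    filter_upwards [hmin, hmax] with y h₁ h₂ using le_antisymm h₂ h₁
  have hzero : deriv (deriv f) z = 0 := by
    rw [hconst.deriv.deriv_eq]
    simp
  rw [hderiv, hf'.deriv] at hzero
  exact hneg.ne hzero

theorem deriv_nonpos_of_left_min {f : ℝ → ℝ} {f' a t : ℝ} (hf : HasDerivAt f f' t) (hat : a < t)
    (hmin : ∀ s ∈ Set.Icc a t, f t ≤ f s) : f' ≤ 0 := by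
  have hslope := (hasDerivWithinAt_iff_tendsto_slope' self_notMem_Iio).1
    (hf.hasDerivWithinAt (s := Set.Iio t))
  refine le_of_tendsto hslope ?_
  filter_upwards [Ioo_mem_nhdsLT hat] with s hs
  rw [slope_def_field]
  exact div_nonpos_of_nonneg_of_nonpos (sub_nonneg.2 (hmin s ⟨hs.1.le, hs.2.le⟩))
    (sub_nonpos.2 hs.2.le)

/-- Maximum principle for a delayed parabolic inequality on `[-h, ∞) × D`, where the differential
inequality is only required of smooth functions touching `v` from above. -/
theorem nonneg_of_delayed_parabolic {h c : ℝ} (hh : 0 < h) {D : Set ℝ} (hD : IsClosed D)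
    {v : ℝ → ℝ → ℝ}
    (hcont : ContinuousOn (fun p : ℝ × ℝ => v p.1 p.2) {p : ℝ × ℝ | -h ≤ p.1})
    (hbdd : ∀ T : ℝ, ∃ M : ℝ, ∀ t ∈ Set.Icc (-h) T, ∀ z : ℝ, -M ≤ v t z)
    (hinit : ∀ t ∈ Set.Icc (-h) 0, ∀ z ∈ D, 0 ≤ v t z)
    (hstep : ∀ t : ℝ, 0 < t → ∀ z ∈ D, (∀ y ∈ D, 0 ≤ v (t - h) y) → v t z < 0 →
      D ∈ nhds z ∧ ∃ (V V' : ℝ → ℝ) (V'' a : ℝ), (∀ y, v t y ≤ V y) ∧ V z = v t z ∧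
        HasDerivAt (fun τ => v τ z) a t ∧ (∀ y, HasDerivAt V (V' y) y) ∧
        HasDerivAt V' V'' z ∧ 0 ≤ a - V'' + c * V' z + v t z) :
    ∀ t ≥ -h, ∀ z ∈ D, 0 ≤ v t z := by
  have key : ∀ n : ℕ, ∀ t ∈ Set.Icc (-h) (n * h), ∀ z ∈ D, 0 ≤ v t z := by
    intro n
    induction n with
    | zero => simpa using hinit
    | succ n ih =>
      by_contra! hcon
      obtain ⟨t₁, ht₁, z₁, hz₁, hv₁⟩ := hcon
      have ht₁pos : 0 < t₁ := by
        by_contra! hle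
        exact absurd (hinit t₁ ⟨ht₁.1, hle⟩ z₁ hz₁) (not_le.2 hv₁)
      set K : ℝ := c ^ 2 + 3 with hK
      have hKpos : 0 < K := by positivity
      obtain ⟨M, hM⟩ := hbdd t₁
      set δ : ℝ := -v t₁ z₁ / (2 * (z₁ ^ 2 + K * t₁ + 1)) with hδ
      have hp₁ : 0 < z₁ ^ 2 + K * t₁ + 1 := by positivity
      have hδpos : 0 < δ := div_pos (neg_pos.2 hv₁) (by positivity)
      let F : ℝ × ℝ → ℝ := fun p => v p.1 p.2 + δ * (p.2 ^ 2 + K * p.1)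
      have hF₁ : F (t₁, z₁) < 0 := by
        have : δ * (2 * (z₁ ^ 2 + K * t₁ + 1)) = -v t₁ z₁ :=
          div_mul_cancel₀ _ (by positivity)
        change v t₁ z₁ + δ * (z₁ ^ 2 + K * t₁) < 0
        nlinarith
      set R : ℝ := |z₁| + |M| / δ + 1 with hR
      have hR1 : 1 ≤ R := by
        have : 0 ≤ |z₁| + |M| / δ := by positivity
        linarith
      have hz₁R : z₁ ∈ Set.Icc (-R) R := by
        rw [Set.mem_Icc, ← abs_le]
        have : 0 ≤ |M| / δ := by positivity
        linarith
      have hout : ∀ t ∈ Set.Icc 0 t₁, ∀ z, z ∉ Set.Icc (-R) R → 0 ≤ F (t, z) := by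
        intro t ht z hz
        rw [Set.mem_Icc, ← abs_le, not_le] at hz
        have h₁ := hM t ⟨by linarith [ht.1], ht.2⟩ z
        have h₂ : |M| / δ ≤ z ^ 2 := by
          have : |M| / δ ≤ R := by
            have := abs_nonneg z₁
            linarith
          rw [← sq_abs z]
          nlinarith
        rw [div_le_iff₀ hδpos] at h₂
        have h₃ : 0 ≤ δ * (K * t) := mul_nonneg hδpos.le (mul_nonneg hKpos.le ht.1)
        change 0 ≤ v t z + δ * (z ^ 2 + K * t)
        nlinarith [le_abs_self M]
      obtain ⟨⟨t₀, z₀⟩, ⟨ht₀, hz₀, hz₀D⟩, hmin⟩ :=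
        (isCompact_Icc.prod (isCompact_Icc.inter_right hD)).exists_isMinOn
          (s := Set.Icc 0 t₁ ×ˢ (Set.Icc (-R) R ∩ D)) (f := F)
          ⟨(t₁, z₁), ⟨ht₁pos.le, le_rfl⟩, hz₁R, hz₁⟩
          ((hcont.mono fun p hp => by
            have := hp.1.1
            simp only [Set.mem_ofPred_eq]
            linarith).add (by fun_prop))
      simp only at ht₀ hz₀ hz₀D
      have hF₀ : F (t₀, z₀) < 0 :=
        (hmin (a := (t₁, z₁)) ⟨⟨ht₁pos.le, le_rfl⟩, hz₁R, hz₁⟩).trans_lt hF₁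
      have hglob : ∀ t ∈ Set.Icc 0 t₁, ∀ z ∈ D, F (t₀, z₀) ≤ F (t, z) := by
        intro t ht z hz
        by_cases hzR : z ∈ Set.Icc (-R) R
        · exact hmin (a := (t, z)) ⟨ht, hzR, hz⟩
        · exact hF₀.le.trans (hout t ht z hzR)
      have hp₀ : 0 ≤ δ * (z₀ ^ 2 + K * t₀) :=
        mul_nonneg hδpos.le (add_nonneg (sq_nonneg _) (mul_nonneg hKpos.le ht₀.1))
      have hv₀ : v t₀ z₀ < 0 := by
        change v t₀ z₀ + δ * (z₀ ^ 2 + K * t₀) < 0 at hF₀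
        linarith
      have ht₀pos : 0 < t₀ := by
        by_contra! hle
        exact absurd (hinit t₀ ⟨by linarith [ht₀.1], hle⟩ z₀ hz₀D) (not_le.2 hv₀)
      have hdelay : ∀ y ∈ D, 0 ≤ v (t₀ - h) y := by
        refine ih (t₀ - h) ⟨by linarith, ?_⟩
        have := ht₁.2
        push_cast at this
        linarith [ht₀.2]
      obtain ⟨hDz, V, V', V'', a, hle, heq, ha, hV, hV', hineq⟩ :=
        hstep t₀ ht₀pos z₀ hz₀D hdelay hv₀
      have hmint : a + δ * K ≤ 0 := by
        have hder : HasDerivAt (fun τ => F (τ, z₀)) (a + δ * K) t₀ := by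
          change HasDerivAt (fun τ => v τ z₀ + δ * (z₀ ^ 2 + K * τ)) _ _
          simpa using
            ha.fun_add ((((hasDerivAt_id' t₀).const_mul K).const_add (z₀ ^ 2)).const_mul δ)
        exact deriv_nonpos_of_left_min hder ht₀pos fun s hs =>
          hglob s ⟨hs.1, hs.2.trans ht₀.2⟩ z₀ hz₀D
      have hW : ∀ y, HasDerivAt (fun y => V y + δ * (y ^ 2 + K * t₀)) (V' y + δ * (2 * y)) y := by
        intro y
        simpa using
          (hV y).fun_add ((((hasDerivAt_id' y).fun_pow 2).add_const (K * t₀)).const_mul δ)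
      have hW' : HasDerivAt (fun y => V' y + δ * (2 * y)) (V'' + δ * 2) z₀ := by
        simpa using hV'.fun_add (((hasDerivAt_id' z₀).const_mul 2).const_mul δ)
      have hminz : IsLocalMin (fun y => V y + δ * (y ^ 2 + K * t₀)) z₀ := by
        filter_upwards [hDz] with y hy
        have := hglob t₀ ht₀ y hy
        change v t₀ z₀ + δ * (z₀ ^ 2 + K * t₀) ≤ v t₀ y + δ * (y ^ 2 + K * t₀) at this
        linarith [hle y]
      have h₁ := hminz.hasDerivAt_eq_zero (hW z₀)
      have h₂ := second_deriv_nonneg_of_isLocalMin hW hW' hminz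
      change v t₀ z₀ + δ * (z₀ ^ 2 + K * t₀) < 0 at hF₀
      have hV'z : V' z₀ = -(δ * (2 * z₀)) := by linarith
      rw [hV'z] at hineq
      have h₃ : 0 < δ * (K - 2 + 2 * c * z₀ + z₀ ^ 2 + K * t₀) := by
        refine mul_pos hδpos ?_
        have : 0 < K * t₀ := mul_pos hKpos ht₀pos
        nlinarith [sq_nonneg (c + z₀)]
      nlinarith
  intro t ht z hz
  obtain ⟨n, hn⟩ := exists_nat_ge (t / h)
  exact key n t ⟨ht, by rwa [div_le_iff₀ hh] at hn⟩ z hz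

theorem eta_pos (lam z : ℝ) : 0 < eta lam z := lt_min (Real.exp_pos _) one_pos

theorem eta_le_one (lam z : ℝ) : eta lam z ≤ 1 := min_le_right _ _

theorem eta_of_nonpos {lam z : ℝ} (hlam : 0 < lam) (hz : z ≤ 0) :
    eta lam z = Real.exp (lam * z) :=
  min_eq_left (Real.exp_le_one_iff.2 (mul_nonpos_of_nonneg_of_nonpos hlam.le hz))

theorem eta_of_nonneg {lam z : ℝ} (hlam : 0 < lam) (hz : 0 ≤ z) : eta lam z = 1 :=
  min_eq_right (Real.one_le_exp (mul_nonneg hlam.le hz))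

theorem eta_mono {lam : ℝ} (hlam : 0 < lam) : Monotone (eta lam) := fun _ _ hxy =>
  min_le_min_right 1 (Real.exp_le_exp.2 (mul_le_mul_of_nonneg_left hxy hlam.le))

theorem exp_neg_mul_eta_le {lam b x z : ℝ} (hlam : 0 < lam) (hb : 0 ≤ b) (hxz : z - b ≤ x) :
    Real.exp (-(lam * b)) * eta lam z ≤ eta lam x := by
  refine le_min ?_ ?_
  · calc Real.exp (-(lam * b)) * eta lam z
        ≤ Real.exp (-(lam * b)) * Real.exp (lam * z) := by
          gcongr
          exact min_le_left _ _
      _ ≤ Real.exp (lam * x) := by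
          rw [← Real.exp_add]
          gcongr
          nlinarith
  · exact mul_le_one₀ (Real.exp_le_one_iff.2 (neg_nonpos.2 (mul_nonneg hlam.le hb)))
      (eta_pos _ _).le (eta_le_one _ _)

theorem hasDerivAt_exp_mul (a y : ℝ) :
    HasDerivAt (fun y => Real.exp (a * y)) (a * Real.exp (a * y)) y := by
  simpa [mul_comm] using ((hasDerivAt_id' y).const_mul a).exp

theorem exists_smooth_touching_eta {lam : ℝ} (hlam : 0 < lam) (z : ℝ) :
    ∃ (E E' : ℝ → ℝ) (E'' : ℝ), (∀ y, eta lam y ≤ E y) ∧ E z = eta lam z ∧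
      (∀ y, HasDerivAt E (E' y) y) ∧ HasDerivAt E' E'' z ∧ 0 ≤ E' z ∧
      E'' ≤ lam ^ 2 * eta lam z ∧ (0 < z → E'' = 0) := by
  rcases le_or_gt z 0 with hz | hz
  · refine ⟨fun y => Real.exp (lam * y), fun y => lam * Real.exp (lam * y),
      lam * (lam * Real.exp (lam * z)), fun y => min_le_left _ _, (eta_of_nonpos hlam hz).symm,
      hasDerivAt_exp_mul lam, (hasDerivAt_exp_mul lam z).const_mul lam, by positivity, ?_,
      fun h => absurd h hz.not_gt⟩
    rw [eta_of_nonpos hlam hz]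
    exact le_of_eq (by ring)
  · exact ⟨fun _ => 1, fun _ => 0, 0, eta_le_one lam, (eta_of_nonneg hlam hz.le).symm,
      fun y => hasDerivAt_const y 1, hasDerivAt_const z 0, le_rfl,
      mul_nonneg (sq_nonneg _) (eta_pos _ _).le, fun _ => rfl⟩

theorem eta_continuous (lam : ℝ) : Continuous (eta lam) := by
  unfold eta
  fun_prop

theorem SolvesE1.reflect {g : ℝ → ℝ} {h c : ℝ} {w : ℝ → ℝ → ℝ} (hw : SolvesE1 g h c w) :
    SolvesE1 (fun u => -g (-u)) h c (fun t z => -w t z) := by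
  obtain ⟨hcont, hbdd, hpde, ht, hz, hzz⟩ := hw
  refine ⟨hcont.neg, fun T => ?_, fun t htpos z => ?_, ?_, ?_, ?_⟩
  · obtain ⟨M, hM⟩ := hbdd T
    exact ⟨M, fun t ht z => by simpa using hM t ht z⟩
  · obtain ⟨h₁, h₂, h₃, h₄⟩ := hpde t htpos z
    refine ⟨h₁.fun_neg, h₂.fun_neg, ?_, ?_⟩
    · simpa [deriv.fun_neg'] using h₃.fun_neg
    · simp only [deriv.fun_neg', h₄, neg_neg]
      ring
  · simpa [deriv.fun_neg'] using ht.fun_neg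
  · simpa [deriv.fun_neg'] using hz.fun_neg
  · simpa [deriv.fun_neg'] using hzz.fun_neg

theorem ContDiff.hasDerivAt_deriv_deriv {Φ : ℝ → ℝ} (hΦ : ContDiff ℝ 2 Φ) :
    (∀ y, HasDerivAt Φ (deriv Φ y) y) ∧ ∀ y, HasDerivAt (deriv Φ) (deriv (deriv Φ) y) y := by
  refine ⟨fun y => (hΦ.differentiable (by norm_num) y).hasDerivAt, fun y => ?_⟩
  have : ContDiff ℝ (1 + 1) Φ := by simpa [one_add_one_eq_two] using hΦ
  exact ((contDiff_succ_iff_deriv.1 this).2.2.differentiable (by norm_num) y).hasDerivAt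

/-- If `Φ(z + σs) + q e^{-γt} η(z)`, with the slowly increasing shift `s`, dominates a solution
initially, then it does so for all times. -/
theorem solution_le_shifted_front {G Φ : ℝ → ℝ} {W : ℝ → ℝ → ℝ}
    {h c lam b d L γ α q qmax σ M : ℝ}
    (hh : 0 < h) (hc : 0 < c) (hlam : 0 < lam) (hb : 0 < b) (hd : 0 < d) (hL : 0 ≤ L)
    (hγ : 0 < γ) (hα : 0 < α) (hq : 0 < q) (hqmax : q ≤ qmax) (hσ : |σ| = 1)
    (hG : Monotone G) (hGlip : ∀ u r : ℝ, 0 ≤ r → G (u + r) - G u ≤ L * r)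
    (hΦ : ContDiff ℝ 2 Φ) (hΦbdd : ∀ z, |Φ z| ≤ M)
    (hprofile : ∀ z, deriv (deriv Φ) z - c * deriv Φ z - Φ z + G (Φ (z - c * h)) = 0)
    (hΦmono : ∀ z s s' : ℝ, s ≤ s' → Φ (z + σ * s) ≤ Φ (z + σ * s'))
    (hΦ'nonneg : ∀ z, 0 ≤ σ * deriv Φ z) (hΦ' : ∀ z ≤ b, d * eta lam z ≤ σ * deriv Φ z)
    (hGG : ∀ x > b, ∀ Q ∈ Set.Icc 0 qmax,
      G (Φ (x - c * h) + Q * Real.exp (γ * h)) - G (Φ (x - c * h)) ≤ Q * (1 - 2 * γ))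
    (hαγ : L * Real.exp (γ * h) + γ + lam ^ 2 ≤ α * γ * d * Real.exp (-(lam * b)))
    (hαq : α * q * Real.exp (γ * h) ≤ b)
    (hW : SolvesE1 G h c W)
    (hinit : ∀ t ∈ Set.Icc (-h) 0, ∀ z, W t z ≤ Φ z + q * eta lam z) :
    ∀ t ≥ -h, ∀ z, W t z ≤ Φ (z + σ * (α * q * (Real.exp (γ * h) - Real.exp (-γ * t))))
      + q * Real.exp (-γ * t) * eta lam z := by
  obtain ⟨hWcont, hWbdd, hpde, -⟩ := hW
  obtain ⟨hΦ₁, hΦ₂⟩ := hΦ.hasDerivAt_deriv_deriv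
  have hαq0 : 0 < α * q := mul_pos hα hq
  set S : ℝ → ℝ := fun t => α * q * (Real.exp (γ * h) - Real.exp (-γ * t)) with hS
  have hSnonneg : ∀ t ≥ -h, 0 ≤ S t := fun t ht =>
    mul_nonneg hαq0.le (sub_nonneg.2 (Real.exp_le_exp.2 (by nlinarith)))
  have hSle : ∀ t, S t ≤ b := fun t => by
    refine le_trans ?_ hαq
    exact mul_le_mul_of_nonneg_left (by linarith [Real.exp_pos (-γ * t)]) hαq0.le
  have hScont : Continuous S := by fun_prop
  have hΦcont : Continuous Φ := hΦ.continuous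
  have hetacont := eta_continuous lam
  have hQderiv : ∀ t, HasDerivAt (fun t => Real.exp (-γ * t)) (-γ * Real.exp (-γ * t)) t :=
    hasDerivAt_exp_mul (-γ)
  suffices hv : ∀ t ≥ -h, ∀ z ∈ (Set.univ : Set ℝ),
      0 ≤ Φ (z + σ * S t) + q * Real.exp (-γ * t) * eta lam z - W t z by
    intro t ht z
    linarith [hv t ht z trivial]
  refine nonneg_of_delayed_parabolic (c := c) hh isClosed_univ ?_ ?_ ?_ ?_
  · exact ContinuousOn.sub (Continuous.continuousOn (by fun_prop)) hWcont
  · intro T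
    obtain ⟨N, hN⟩ := hWbdd T
    refine ⟨M + N, fun t ht z => ?_⟩
    have h₁ := abs_le.1 (hN t ht z)
    have h₂ := abs_le.1 (hΦbdd (z + σ * S t))
    have h₃ : 0 ≤ q * Real.exp (-γ * t) * eta lam z :=
      mul_nonneg (by positivity) (eta_pos _ _).le
    linarith
  · intro t ht z _
    have h₁ := hinit t ht z
    have h₂ := hΦmono z 0 (S t) (hSnonneg t ht.1)
    have h₃ : q * 1 * eta lam z ≤ q * Real.exp (-γ * t) * eta lam z := by
      gcongr
      · exact (eta_pos _ _).le
      · exact Real.one_le_exp (by nlinarith [ht.2])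
    simp only [mul_zero, add_zero] at h₂
    linarith
  · intro t ht z _ hdelay _
    obtain ⟨hWt, -, hWzz, heq⟩ := hpde t ht z
    obtain ⟨E, E', E'', hE, hEz, hE₁, hE₂, hE'z, hE''le, hE''z⟩ :=
      exists_smooth_touching_eta hlam z
    set x : ℝ := z + σ * S t with hx
    set Q : ℝ := q * Real.exp (-γ * t) with hQ
    have hQpos : 0 < Q := by positivity
    refine ⟨Filter.univ_mem, fun y => Φ (y + σ * S t) + Q * E y - W t y,
      fun y => deriv Φ (y + σ * S t) + Q * E' y - deriv (fun y => W t y) y,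
      deriv (deriv Φ) x + Q * E'' - deriv (deriv fun y => W t y) z,
      deriv Φ x * (σ * (α * q * (γ * Real.exp (-γ * t))))
        + q * (-γ * Real.exp (-γ * t)) * eta lam z - deriv (fun τ => W τ z) t,
      fun y => ?_, by simp only [hEz, x], ?_, fun y => ?_, ?_, ?_⟩
    · have := mul_le_mul_of_nonneg_left (hE y) hQpos.le
      linarith
    · have hSd : HasDerivAt (fun t => z + σ * S t)
          (σ * (α * q * (γ * Real.exp (-γ * t)))) t := by
        have := ((((hQderiv t).const_sub (Real.exp (γ * h))).const_mul (α * q)).const_mul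
          σ).const_add z
        simpa [S] using this
      exact (((hΦ₁ x).comp t hSd).fun_add
        (((hQderiv t).const_mul q).mul_const (eta lam z))).fun_sub hWt.hasDerivAt
    · exact (((hΦ₁ _).comp_add_const y _).fun_add ((hE₁ y).const_mul Q)).fun_sub
        ((hpde t ht y).2.1.hasDerivAt)
    · exact (((hΦ₂ _).comp_add_const z _).fun_add (hE₂.const_mul Q)).fun_sub hWzz.hasDerivAt
    · have hprof := hprofile x
      have hWd : W (t - h) (z - c * h) ≤
          Φ (x - c * h) + Q * Real.exp (γ * h) * eta lam (z - c * h) := by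
        have h₁ := hdelay (z - c * h) trivial
        have h₂ : Φ (z - c * h + σ * S (t - h)) ≤ Φ (x - c * h) := by
          have hSmono : S (t - h) ≤ S t := by
            have : Real.exp (-γ * t) ≤ Real.exp (-γ * (t - h)) :=
              Real.exp_le_exp.2 (by nlinarith)
            exact mul_le_mul_of_nonneg_left (by linarith) hαq0.le
          have := hΦmono (z - c * h) _ _ hSmono
          rwa [show z - c * h + σ * S t = x - c * h by rw [hx]; ring] at this
        have h₃ : q * Real.exp (-γ * (t - h)) = Q * Real.exp (γ * h) := by
          rw [hQ, mul_assoc, ← Real.exp_add]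
          ring_nf
        rw [h₃] at h₁
        linarith
      have hGd := hG hWd
      have heta := eta_pos lam z
      have hQE' : 0 ≤ c * (Q * E' z) := by positivity
      have hshift : deriv Φ x * (σ * (α * q * (γ * Real.exp (-γ * t)))) =
          α * γ * Q * (σ * deriv Φ x) := by
        rw [hQ]
        ring
      have hdecay : q * (-γ * Real.exp (-γ * t)) * eta lam z = -γ * Q * eta lam z := by
        rw [hQ]
        ring
      have hdist : |x - z| ≤ b := by
        rw [hx, add_sub_cancel_left, abs_mul, hσ, one_mul, abs_of_nonneg (hSnonneg t (by linarith))]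
        exact hSle t
      have hαγQ : 0 < α * γ * Q := by positivity
      rw [hshift, hdecay, heq]
      change 0 ≤ _ - _ + c * (deriv Φ x + Q * E' z - _) + (Φ x + Q * eta lam z - _)
      rcases le_or_gt x b with hxb | hxb
      · have h₁ : d * (Real.exp (-(lam * b)) * eta lam z) ≤ σ * deriv Φ x :=
          (mul_le_mul_of_nonneg_left (exp_neg_mul_eta_le hlam hb.le
            (by linarith [(abs_le.1 hdist).1])) hd.le).trans (hΦ' x hxb)
        have h₂ := mul_le_mul_of_nonneg_left h₁ hαγQ.le
        have h₃ := mul_le_mul_of_nonneg_right hαγ (mul_pos hQpos heta).le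
        have h₄ := hGlip (Φ (x - c * h)) (Q * Real.exp (γ * h) * eta lam (z - c * h))
          (mul_nonneg (by positivity) (eta_pos _ _).le)
        have h₅ : L * (Q * Real.exp (γ * h) * eta lam (z - c * h)) ≤
            L * (Q * Real.exp (γ * h) * eta lam z) := by
          gcongr
          exact eta_mono hlam (by nlinarith)
        have h₆ := mul_le_mul_of_nonneg_left hE''le hQpos.le
        have h₇ : 0 < Q * eta lam z := mul_pos hQpos heta
        linarith
      · have hz : 0 < z := by linarith [(abs_le.1 hdist).2]
        have h₁ := hGG x hxb Q ⟨hQpos.le, le_trans (mul_le_of_le_one_right hq.le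
          (Real.exp_le_one_iff.2 (by nlinarith))) hqmax⟩
        have h₂ : G (Φ (x - c * h) + Q * Real.exp (γ * h) * eta lam (z - c * h)) ≤
            G (Φ (x - c * h) + Q * Real.exp (γ * h)) := by
          refine hG (add_le_add_right ?_ _)
          exact mul_le_of_le_one_right (by positivity) (eta_le_one _ _)
        have h₃ := mul_nonneg hαγQ.le (hΦ'nonneg x)
        have h₄ : 0 < γ * Q := mul_pos hγ hQpos
        rw [hE''z hz, eta_of_nonneg hlam hz.le]
        linarith

theorem solution_le_add_stationary_on_Iic {G Φ ψ ψ' ψ'' : ℝ → ℝ} {W : ℝ → ℝ → ℝ}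
    {h c Z M : ℝ} (hh : 0 < h) (hc : 0 < c) (hG : Monotone G)
    (hΦ : ContDiff ℝ 2 Φ) (hΦbdd : ∀ z, |Φ z| ≤ M)
    (hprofile : ∀ z, deriv (deriv Φ) z - c * deriv Φ z - Φ z + G (Φ (z - c * h)) = 0)
    (hψ : ∀ y, HasDerivAt ψ (ψ' y) y) (hψ' : ∀ y, HasDerivAt ψ' (ψ'' y) y)
    (hψnonneg : ∀ y, 0 ≤ ψ y)
    (hψsuper : ∀ z ≤ Z, G (Φ (z - c * h) + ψ (z - c * h)) - G (Φ (z - c * h)) ≤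
      -ψ'' z + c * ψ' z + ψ z)
    (hW : SolvesE1 G h c W)
    (hinit : ∀ t ∈ Set.Icc (-h) 0, ∀ z ≤ Z, W t z ≤ Φ z + ψ z)
    (hbdry : ∀ t > 0, W t Z ≤ Φ Z + ψ Z) :
    ∀ t ≥ -h, ∀ z ≤ Z, W t z ≤ Φ z + ψ z := by
  obtain ⟨hWcont, hWbdd, hpde, -⟩ := hW
  obtain ⟨hΦ₁, hΦ₂⟩ := hΦ.hasDerivAt_deriv_deriv
  have hΦcont : Continuous Φ := hΦ.continuous
  have hψcont : Continuous ψ := continuous_iff_continuousAt.2 fun y => (hψ y).continuousAt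
  suffices hv : ∀ t ≥ -h, ∀ z ∈ Set.Iic Z, 0 ≤ Φ z + ψ z - W t z by
    intro t ht z hz
    linarith [hv t ht z hz]
  refine nonneg_of_delayed_parabolic (c := c) hh isClosed_Iic ?_ ?_ ?_ ?_
  · exact ContinuousOn.sub (Continuous.continuousOn (by fun_prop)) hWcont
  · intro T
    obtain ⟨N, hN⟩ := hWbdd T
    refine ⟨M + N, fun t ht z => ?_⟩
    have h₁ := abs_le.1 (hN t ht z)
    have h₂ := abs_le.1 (hΦbdd z)
    linarith [hψnonneg z]
  · intro t ht z hz
    linarith [hinit t ht z hz]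
  · intro t ht z hz hdelay hneg
    have hzZ : z < Z := by
      refine lt_of_le_of_ne hz fun hzZ => ?_
      subst hzZ
      linarith [hbdry t ht]
    obtain ⟨hWt, -, hWzz, heq⟩ := hpde t ht z
    refine ⟨Iic_mem_nhds hzZ, fun y => Φ y + ψ y - W t y,
      fun y => deriv Φ y + ψ' y - deriv (fun y => W t y) y,
      deriv (deriv Φ) z + ψ'' z - deriv (deriv fun y => W t y) z,
      -deriv (fun τ => W τ z) t, fun y => le_rfl, rfl, hWt.hasDerivAt.const_sub _,
      fun y => ((hΦ₁ y).fun_add (hψ y)).fun_sub (hpde t ht y).2.1.hasDerivAt,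
      ((hΦ₂ z).fun_add (hψ' z)).fun_sub hWzz.hasDerivAt, ?_⟩
    have hd := hdelay (z - c * h) (by simp only [Set.mem_Iic] at hz ⊢; nlinarith)
    have hGd := hG (show W (t - h) (z - c * h) ≤ Φ (z - c * h) + ψ (z - c * h) by linarith)
    have h₁ := hψsuper z hz
    have h₂ := hprofile z
    rw [heq]
    linarith

theorem solution_le_add_eta {G Φ : ℝ → ℝ} {W : ℝ → ℝ → ℝ}
    {h c lam lam' b d L γ α q qmax σ M Λ Z δ : ℝ}
    (hh : 0 < h) (hc : 0 < c) (hlam : 0 < lam) (hlam' : lam ≤ lam') (hb : 0 < b) (hd : 0 < d)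
    (hL : 0 ≤ L) (hγ : 0 < γ) (hα : 0 < α) (hq : 0 < q) (hqmax : q ≤ qmax) (hσ : |σ| = 1)
    (hδ : 0 < δ) (hZ : Z ≤ 0) (hG : Monotone G)
    (hGlip : ∀ u r : ℝ, 0 ≤ r → G (u + r) - G u ≤ L * r)
    (hΦ : ContDiff ℝ 2 Φ) (hΦbdd : ∀ z, |Φ z| ≤ M) (hΦlip : ∀ x y, |Φ x - Φ y| ≤ Λ * |x - y|)
    (hprofile : ∀ z, deriv (deriv Φ) z - c * deriv Φ z - Φ z + G (Φ (z - c * h)) = 0)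
    (hΦmono : ∀ z s s' : ℝ, s ≤ s' → Φ (z + σ * s) ≤ Φ (z + σ * s'))
    (hΦ'nonneg : ∀ z, 0 ≤ σ * deriv Φ z) (hΦ' : ∀ z ≤ b, d * eta lam z ≤ σ * deriv Φ z)
    (hGG : ∀ x > b, ∀ Q ∈ Set.Icc 0 qmax,
      G (Φ (x - c * h) + Q * Real.exp (γ * h)) - G (Φ (x - c * h)) ≤ Q * (1 - 2 * γ))
    (hαγ : L * Real.exp (γ * h) + γ + lam ^ 2 ≤ α * γ * d * Real.exp (-(lam * b)))
    (hαq : α * q * Real.exp (γ * h) ≤ b)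
    (hqZ : q * (Λ * (α * Real.exp (γ * h)) + 1) ≤ δ * Real.exp (lam * Z)) (hqδ : q ≤ δ)
    (hsuper : ∀ z ≤ Z,
      G (Φ (z - c * h) + δ * (Real.exp (lam * (z - c * h)) + Real.exp (lam' * (z - c * h))))
          - G (Φ (z - c * h)) ≤
        δ * ((-lam ^ 2 + c * lam + 1) * Real.exp (lam * z)
          + (-lam' ^ 2 + c * lam' + 1) * Real.exp (lam' * z)))
    (hW : SolvesE1 G h c W)
    (hinit : ∀ t ∈ Set.Icc (-h) 0, ∀ z, W t z ≤ Φ z + q * eta lam z) :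
    ∀ t ≥ 0, ∀ z, W t z ≤ Φ z + 2 * δ * eta lam z := by
  have hΛ : 0 ≤ Λ := by simpa using (abs_nonneg _).trans (hΦlip 1 0)
  have hright : ∀ t ≥ 0, ∀ z, W t z ≤ Φ z + δ * Real.exp (lam * Z) := by
    intro t ht z
    have h₁ := solution_le_shifted_front hh hc hlam hb hd hL hγ hα hq hqmax hσ hG hGlip hΦ hΦbdd
      hprofile hΦmono hΦ'nonneg hΦ' hGG hαγ hαq hW hinit t (by linarith) z
    set S : ℝ := α * q * (Real.exp (γ * h) - Real.exp (-γ * t)) with hS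
    have hexp : Real.exp (-γ * t) ≤ 1 := Real.exp_le_one_iff.2 (by nlinarith)
    have hexp' : 1 ≤ Real.exp (γ * h) := Real.one_le_exp (by positivity)
    have hS0 : 0 ≤ S := mul_nonneg (by positivity) (by linarith)
    have hS1 : S ≤ α * q * Real.exp (γ * h) :=
      mul_le_mul_of_nonneg_left (by linarith [Real.exp_pos (-γ * t)]) (by positivity)
    have h₂ := (abs_le.1 (hΦlip (z + σ * S) z)).2
    rw [add_sub_cancel_left, abs_mul, hσ, one_mul, abs_of_nonneg hS0] at h₂
    have h₃ := mul_le_mul_of_nonneg_left hS1 hΛ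
    have h₄ : q * Real.exp (-γ * t) * eta lam z ≤ q * 1 * 1 := by
      gcongr
      · exact (eta_pos _ _).le
      · exact eta_le_one _ _
    linarith
  have hexpZ : ∀ z ≥ Z, Real.exp (lam * Z) ≤ eta lam z := fun z hz =>
    (eta_of_nonpos hlam hZ).symm.le.trans (eta_mono hlam hz)
  intro t ht z
  rcases le_total z Z with hz | hz
  · have h₁ := solution_le_add_stationary_on_Iic (Z := Z) (W := W)
      (ψ := fun y => δ * (Real.exp (lam * y) + Real.exp (lam' * y)))
      (ψ' := fun y => δ * (lam * Real.exp (lam * y) + lam' * Real.exp (lam' * y)))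
      (ψ'' := fun y => δ * (lam * (lam * Real.exp (lam * y))
        + lam' * (lam' * Real.exp (lam' * y))))
      hh hc hG hΦ hΦbdd hprofile
      (fun y => ((hasDerivAt_exp_mul lam y).fun_add (hasDerivAt_exp_mul lam' y)).const_mul δ)
      (fun y => (((hasDerivAt_exp_mul lam y).const_mul lam).fun_add
        ((hasDerivAt_exp_mul lam' y).const_mul lam')).const_mul δ)
      (fun y => by positivity)
      (fun z hz => (hsuper z hz).trans (le_of_eq (by ring)))
      hW
      (fun s hs y hy => (hinit s hs y).trans <| by
        rw [eta_of_nonpos hlam (hy.trans hZ)]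
        have := mul_le_mul_of_nonneg_right hqδ (Real.exp_pos (lam * y)).le
        have : 0 < δ * Real.exp (lam' * y) := by positivity
        linarith)
      (fun s hs => (hright s hs.le Z).trans <| by
        have : 0 < δ * Real.exp (lam' * Z) := by positivity
        linarith)
      t (by linarith) z hz
    refine h₁.trans ?_
    rw [eta_of_nonpos hlam (hz.trans hZ)]
    have h₂ : Real.exp (lam' * z) ≤ Real.exp (lam * z) :=
      Real.exp_le_exp.2 (mul_le_mul_of_nonpos_right hlam' (hz.trans hZ))
    have := mul_le_mul_of_nonneg_left h₂ hδ.le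
    linarith
  · have h₁ := mul_le_mul_of_nonneg_left (hexpZ z hz) hδ.le
    have h₂ := mul_pos hδ (eta_pos lam z)
    linarith [hright t ht z]

theorem chi_neg_of_mem_Ioo {g0 c h lam₁ lam₂ lam : ℝ} (hg0 : 0 ≤ g0)
    (h₁ : chi g0 c h lam₁ = 0) (h₂ : chi g0 c h lam₂ = 0) (hlam : lam ∈ Set.Ioo lam₁ lam₂) :
    chi g0 c h lam < 0 := by
  obtain ⟨hl, hr⟩ := hlam
  have hlt : 0 < lam₂ - lam₁ := by linarith
  have hsum : (lam₂ - lam) / (lam₂ - lam₁) + (lam - lam₁) / (lam₂ - lam₁) = 1 := by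
    field_simp
    ring
  have hexp := convexOn_exp.2 (Set.mem_univ (-(lam₁ * c * h))) (Set.mem_univ (-(lam₂ * c * h)))
    (div_nonneg (by linarith : 0 ≤ lam₂ - lam) hlt.le)
    (div_nonneg (by linarith : 0 ≤ lam - lam₁) hlt.le) hsum
  have hcomb : (lam₂ - lam) / (lam₂ - lam₁) * lam₁ + (lam - lam₁) / (lam₂ - lam₁) * lam₂ = lam := by
    field_simp
    ring
  set p := (lam₂ - lam) / (lam₂ - lam₁)
  set r := (lam - lam₁) / (lam₂ - lam₁)
  have hp : 0 < p := div_pos (by linarith) hlt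
  have hr' : 0 < r := div_pos (by linarith) hlt
  simp only [smul_eq_mul] at hexp
  rw [show p * -(lam₁ * c * h) + r * -(lam₂ * c * h) = -(lam * c * h) by
    rw [← hcomb]; ring] at hexp
  have hexp' := mul_le_mul_of_nonneg_left hexp hg0
  unfold chi at *
  have hsq : lam ^ 2 < p * lam₁ ^ 2 + r * lam₂ ^ 2 := by
    have hprod : 0 < p * r * (lam₂ - lam₁) ^ 2 := by positivity
    rw [← hcomb]
    have hpe : p = 1 - r := by linarith
    rw [hpe] at hprod ⊢
    nlinarith
  have e₁ := congrArg (p * ·) h₁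
  have e₂ := congrArg (r * ·) h₂
  simp only [mul_zero] at e₁ e₂
  have hlin : c * lam = c * (p * lam₁ + r * lam₂) := by rw [hcomb]
  nlinarith

theorem exists_half_shift {g φ : ℝ → ℝ} {c h a u₀ Z : ℝ} (hh : 0 < h) (hc : 0 < c) (ha : 0 < a)
    (hgcont : Continuous g) (hg : ∀ u ∈ Set.Icc 0 u₀, (1 + a) * u ≤ g u)
    (hφ : ContDiff ℝ 2 φ) (hφpos : ∀ z, 0 < φ z) (hφmono : Monotone φ)
    (hprofile : ∀ z, deriv (deriv φ) z - c * deriv φ z - φ z + g (φ (z - c * h)) = 0)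
    (hZ : φ Z ≤ u₀) : ∃ T > 0, ∀ z ≤ Z, φ (z - T) ≤ φ z / 2 := by
  set N : ℝ := 2 * (1 + c + c * h) / a with hN
  have hNpos : 0 < N := by positivity
  have hch : 0 < c * h := mul_pos hc hh
  obtain ⟨hφ₁, hφ₂⟩ := hφ.hasDerivAt_deriv_deriv
  have hφcont : Continuous φ := hφ.continuous
  have hφ'cont : Continuous (deriv φ) := hφ.continuous_deriv (by norm_num)
  refine ⟨c * h + N + 1, by positivity, fun z hz => ?_⟩
  obtain ⟨y, hy, hslope⟩ := exists_deriv_eq_slope φ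
    (show z - c * h - N - 1 < z - c * h - N by linarith) hφcont.continuousOn
    (fun x _ => (hφ₁ x).differentiableAt.differentiableWithinAt)
  have hφ'y : deriv φ y ≤ φ z := by
    rw [hslope, show z - c * h - N - (z - c * h - N - 1) = 1 by ring, div_one]
    linarith [hφpos (z - c * h - N - 1), hφmono (show z - c * h - N ≤ z by linarith)]
  have hφ'z : 0 ≤ deriv φ z := hφmono.deriv_nonneg
  have hyz : y ≤ z - c * h := by linarith [hy.2]
  have hii : ∀ p r : ℝ, IntervalIntegrable φ MeasureTheory.volume p r :=
    fun p r => hφcont.intervalIntegrable p r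
  have hFTC : ∫ s in y..z, (φ s - g (φ (s - c * h))) =
      (deriv φ z - c * φ z) - (deriv φ y - c * φ y) := by
    refine intervalIntegral.integral_eq_sub_of_hasDerivAt (f := fun s => deriv φ s - c * φ s)
      (fun s _ => ?_) (Continuous.intervalIntegrable (by fun_prop) _ _)
    refine ((hφ₂ s).fun_sub ((hφ₁ s).const_mul c)).congr_deriv ?_
    linarith [hprofile s]
  rw [intervalIntegral.integral_sub (hii _ _)
    (Continuous.intervalIntegrable (by fun_prop) _ _)] at hFTC
  have hgint : (1 + a) * ∫ s in (y - c * h)..(z - c * h), φ s ≤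
      ∫ s in y..z, g (φ (s - c * h)) := by
    rw [← intervalIntegral.integral_comp_sub_right (fun s => φ s),
      ← intervalIntegral.integral_const_mul]
    refine intervalIntegral.integral_mono_on (by linarith)
      (Continuous.intervalIntegrable (by fun_prop) _ _)
      (Continuous.intervalIntegrable (by fun_prop) _ _) fun s hs => ?_
    exact hg _ ⟨(hφpos _).le, (hφmono (by linarith [hs.2])).trans hZ⟩
  have hsplit₁ := intervalIntegral.integral_add_adjacent_intervals (hii (y - c * h) y)
    (hii y (z - c * h))
  have hsplit₂ := intervalIntegral.integral_add_adjacent_intervals (hii y (z - c * h))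
    (hii (z - c * h) z)
  have hpos : 0 ≤ ∫ s in (y - c * h)..y, φ s :=
    intervalIntegral.integral_nonneg (by linarith) fun s _ => (hφpos s).le
  have hlast : ∫ s in (z - c * h)..z, φ s ≤ c * h * φ z := by
    have := intervalIntegral.integral_mono_on (by linarith) (hii (z - c * h) z)
      (intervalIntegrable_const (c := φ z)) fun s hs => hφmono hs.2
    simpa using this
  have hmid : N * φ (z - (c * h + N + 1)) ≤ ∫ s in y..(z - c * h), φ s := by
    have h₁ := intervalIntegral.integral_mono_on hyz
      (intervalIntegrable_const (c := φ (z - (c * h + N + 1)))) (hii y (z - c * h))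
      fun s hs => hφmono (by linarith [hs.1, hy.1])
    rw [intervalIntegral.integral_const, smul_eq_mul] at h₁
    refine le_trans (mul_le_mul_of_nonneg_right ?_ (hφpos _).le) h₁
    linarith [hy.2]
  have haN : a * N = 2 * (1 + c + c * h) := by
    rw [hN]
    field_simp
  have hmid' := mul_le_mul_of_nonneg_left hmid ha.le
  rw [← mul_assoc, haN] at hmid'
  have hapos := mul_nonneg ha.le hpos
  have hcy := mul_pos hc (hφpos y)
  have hfinal : 2 * (1 + c + c * h) * φ (z - (c * h + N + 1)) ≤ (1 + c + c * h) * φ z := by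
    nlinarith
  have : 0 < 1 + c + c * h := by positivity
  nlinarith

theorem exists_exp_bound_of_half_shift {φ : ℝ → ℝ} {T Z : ℝ} (hT : 0 < T) (hφpos : ∀ z, 0 < φ z)
    (hφmono : Monotone φ) (hhalf : ∀ z ≤ Z, φ (z - T) ≤ φ z / 2) :
    ∃ A > 0, ∃ μ > 0, ∀ z ≤ Z, φ z ≤ A * Real.exp (μ * z) := by
  have hlog : 0 < Real.log 2 := Real.log_pos one_lt_two
  have hpow : ∀ n : ℕ, φ (Z - n * T) ≤ φ Z * Real.exp (-(Real.log 2 * n)) := by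
    intro n
    induction n with
    | zero => simp
    | succ n ih =>
      have h₁ := hhalf (Z - n * T) (by
        have : 0 ≤ n * T := by positivity
        linarith)
      rw [show Z - ((n + 1 : ℕ) : ℝ) * T = Z - n * T - T by push_cast; ring]
      have h₂ : Real.exp (-(Real.log 2 * (n + 1 : ℕ))) =
          Real.exp (-(Real.log 2 * n)) / 2 := by
        rw [show -(Real.log 2 * ((n + 1 : ℕ) : ℝ)) = -(Real.log 2 * n) - Real.log 2 by
          push_cast; ring, Real.exp_sub, Real.exp_log two_pos]
      rw [h₂]
      linarith
  refine ⟨2 * φ Z * Real.exp (-(Real.log 2 / T * Z)), by have := hφpos Z; positivity,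
    Real.log 2 / T, by positivity, fun z hz => ?_⟩
  have hnonneg : 0 ≤ (Z - z) / T := div_nonneg (by linarith) hT.le
  have h₁ := Nat.floor_le hnonneg
  have h₂ := Nat.lt_floor_add_one ((Z - z) / T)
  set n := ⌊(Z - z) / T⌋₊
  rw [le_div_iff₀ hT] at h₁
  refine (hφmono (show z ≤ Z - n * T by linarith)).trans ((hpow n).trans ?_)
  have h₃ : Real.exp (-(Real.log 2 * n)) ≤
      2 * (Real.exp (-(Real.log 2 / T * Z)) * Real.exp (Real.log 2 / T * z)) := by
    conv_rhs => rw [← Real.exp_add, ← Real.exp_log two_pos, ← Real.exp_add]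
    rw [Real.exp_log two_pos]
    refine Real.exp_le_exp.2 ?_
    have := mul_le_mul_of_nonneg_left h₂.le hlog.le
    rw [show Real.log 2 * ((Z - z) / T) = Real.log 2 / T * Z - Real.log 2 / T * z by ring] at this
    linarith
  have := mul_le_mul_of_nonneg_left h₃ (hφpos Z).le
  linarith

theorem exists_linear_tail_supersolution {g φ : ℝ → ℝ} {g0 C θ ρ A μ Z₀ c h lam₁ lam₂ : ℝ}
    (hh : 0 < h) (hc : 0 < c) (hlam₁ : 0 < lam₁) (hlam : lam₁ < lam₂) (hg0 : 0 ≤ g0)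
    (hC : 0 < C) (hθ : 0 < θ) (hρ : 0 < ρ) (hA : 0 < A) (hμ : 0 < μ)
    (h₁ : chi g0 c h lam₁ = 0) (h₂ : chi g0 c h lam₂ = 0)
    (hg : ∀ u v : ℝ, -ρ < u → u ≤ v → 0 < v → v < ρ →
      g v - g u ≤ (g0 + C * v ^ θ) * (v - u))
    (hφ : ∀ z ≤ Z₀, φ z ≤ A * Real.exp (μ * z)) :
    ∃ lam' > lam₁, ∃ Z ≤ 0, ∀ δ ∈ Set.Ioc (0 : ℝ) 1, ∀ z ≤ Z, ∀ u v ψ : ℝ,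
      ψ = δ * (Real.exp (lam₁ * (z - c * h)) + Real.exp (lam' * (z - c * h))) →
      -ψ ≤ u → v = u + ψ → 0 < v → v ≤ φ (z - c * h) + ψ →
      g v - g u ≤ δ * ((-lam₁ ^ 2 + c * lam₁ + 1) * Real.exp (lam₁ * z)
          + (-lam' ^ 2 + c * lam' + 1) * Real.exp (lam' * z)) := by
  set m : ℝ := min μ lam₁ with hm
  have hmpos : 0 < m := lt_min hμ hlam₁
  set ν : ℝ := min (m * θ / 2) ((lam₂ - lam₁) / 2) with hν
  have hνpos : 0 < ν := lt_min (by positivity) (by linarith)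
  have hνθ : 2 * ν ≤ m * θ := by linarith [min_le_left (m * θ / 2) ((lam₂ - lam₁) / 2)]
  have hchi : chi g0 c h (lam₁ + ν) < 0 := by
    refine chi_neg_of_mem_Ioo hg0 h₁ h₂ ⟨by linarith, ?_⟩
    linarith [min_le_right (m * θ / 2) ((lam₂ - lam₁) / 2)]
  have hexp : ∀ k > 0, Filter.Tendsto (fun z : ℝ => Real.exp (k * z)) Filter.atBot (nhds 0) :=
    fun k hk => Real.tendsto_exp_atBot.comp (Filter.tendsto_id.const_mul_atBot hk)
  have hev₁ : ∀ᶠ z : ℝ in Filter.atBot, (A + 2) * Real.exp (m * z) < ρ := by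
    have := (hexp m hmpos).const_mul (A + 2)
    rw [mul_zero] at this
    exact this.eventually_lt_const hρ
  have hev₂ : ∀ᶠ z : ℝ in Filter.atBot,
      2 * C * (A + 2) ^ θ * Real.exp (ν * z) < -chi g0 c h (lam₁ + ν) := by
    have := (hexp ν hνpos).const_mul (2 * C * (A + 2) ^ θ)
    rw [mul_zero] at this
    exact this.eventually_lt_const (by linarith)
  obtain ⟨Z₁, hZ₁⟩ := Filter.eventually_atBot.1 (hev₁.and hev₂)
  refine ⟨lam₁ + ν, by linarith, min (min Z₀ Z₁) 0, min_le_right _ _, ?_⟩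
  intro δ hδ z hz u v ψ hψ hu hv hvpos hvle
  have hz0 : z ≤ 0 := hz.trans (min_le_right _ _)
  have hzZ₀ : z ≤ Z₀ := hz.trans ((min_le_left _ _).trans (min_le_left _ _))
  obtain ⟨hsmall, hsmall'⟩ := hZ₁ z (hz.trans ((min_le_left _ _).trans (min_le_right _ _)))
  have hch : 0 < c * h := mul_pos hc hh
  have hexp_le : ∀ k ≥ m, Real.exp (k * (z - c * h)) ≤ Real.exp (m * z) := fun k hk =>
    Real.exp_le_exp.2 (by nlinarith)
  have hlamexp : Real.exp (lam₁ * (z - c * h)) ≤ Real.exp (lam₁ * z) :=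
    Real.exp_le_exp.2 (by nlinarith)
  have hlamexp' : Real.exp ((lam₁ + ν) * (z - c * h)) ≤ Real.exp (lam₁ * z) :=
    Real.exp_le_exp.2 (by nlinarith)
  have hψpos : 0 < ψ := hψ ▸ mul_pos hδ.1 (by positivity)
  have hψle : ψ ≤ 2 * Real.exp (m * z) := by
    have e₁ := hexp_le lam₁ (min_le_right _ _)
    have e₂ := hexp_le (lam₁ + ν) (by linarith [min_le_right μ lam₁])
    have : ψ ≤ 1 * (Real.exp (m * z) + Real.exp (m * z)) := by
      rw [hψ]
      exact mul_le_mul hδ.2 (by linarith) (by positivity) one_pos.le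
    linarith
  have hφle : φ (z - c * h) ≤ A * Real.exp (m * z) :=
    (hφ _ (by linarith)).trans (mul_le_mul_of_nonneg_left (hexp_le μ (min_le_left _ _)) hA.le)
  have hvle' : v ≤ (A + 2) * Real.exp (m * z) := by linarith
  have hAe : 0 < A * Real.exp (m * z) := by positivity
  have hmain := hg u v (by linarith) (by linarith) hvpos (by linarith)
  rw [hv, add_sub_cancel_left, ← hv] at hmain
  have hpow : v ^ θ ≤ (A + 2) ^ θ * (Real.exp (ν * z) * Real.exp (ν * z)) := by
    calc v ^ θ ≤ ((A + 2) * Real.exp (m * z)) ^ θ := by gcongr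
      _ = (A + 2) ^ θ * Real.exp (m * z * θ) := by
        rw [Real.mul_rpow (by positivity) (by positivity), ← Real.exp_mul]
      _ ≤ (A + 2) ^ θ * (Real.exp (ν * z) * Real.exp (ν * z)) := by
        rw [← Real.exp_add]
        gcongr
        nlinarith
  have hψle' : ψ ≤ δ * (2 * Real.exp (lam₁ * z)) := by
    rw [hψ]
    exact mul_le_mul_of_nonneg_left (by linarith) hδ.1.le
  have hnonlin : C * v ^ θ * ψ ≤
      δ * (-chi g0 c h (lam₁ + ν) * (Real.exp (ν * z) * Real.exp (lam₁ * z))) := by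
    calc C * v ^ θ * ψ
        ≤ C * ((A + 2) ^ θ * (Real.exp (ν * z) * Real.exp (ν * z))) *
          (δ * (2 * Real.exp (lam₁ * z))) := by gcongr
      _ = δ * ((2 * C * (A + 2) ^ θ * Real.exp (ν * z)) *
          (Real.exp (ν * z) * Real.exp (lam₁ * z))) := by ring
      _ ≤ _ := by
        have := hδ.1
        gcongr
  have hlinear : g0 * ψ + δ * (-chi g0 c h (lam₁ + ν) * (Real.exp (ν * z) * Real.exp (lam₁ * z)))
      = δ * ((-lam₁ ^ 2 + c * lam₁ + 1) * Real.exp (lam₁ * z)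
        + (-(lam₁ + ν) ^ 2 + c * (lam₁ + ν) + 1) * Real.exp ((lam₁ + ν) * z)) := by
    have e₁ : Real.exp (ν * z) * Real.exp (lam₁ * z) = Real.exp ((lam₁ + ν) * z) := by
      rw [← Real.exp_add]
      ring_nf
    have e₂ : ∀ k : ℝ, Real.exp (k * (z - c * h)) = Real.exp (-(k * c * h)) * Real.exp (k * z) := by
      intro k
      rw [← Real.exp_add]
      ring_nf
    have e₃ : g0 * Real.exp (-(lam₁ * c * h)) = -lam₁ ^ 2 + c * lam₁ + 1 := by
      unfold chi at h₁
      linarith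
    rw [e₁, hψ, e₂, e₂, ← e₃]
    unfold chi
    ring
  linarith

theorem abs_sub_le_of_profile {g φ : ℝ → ℝ} {c h B : ℝ} (hc : 0 < c)
    (hφ : ContDiff ℝ 2 φ) (hφ0 : ∀ z, 0 ≤ φ z) (hφB : ∀ z, φ z ≤ B) (hφmono : Monotone φ)
    (hgB : ∀ z, g (φ z) ≤ B)
    (hprofile : ∀ z, deriv (deriv φ) z - c * deriv φ z - φ z + g (φ (z - c * h)) = 0) (x y : ℝ) :
    |φ x - φ y| ≤ 2 * B * |x - y| := by
  obtain ⟨hφ₁, hφ₂⟩ := hφ.hasDerivAt_deriv_deriv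
  have hB : 0 ≤ B := (hφ0 0).trans (hφB 0)
  have hbound : ∀ z, deriv φ z ≤ 2 * B := by
    intro z
    obtain ⟨ξ, hξ, hslope⟩ := exists_deriv_eq_slope φ (show z < z + 1 by linarith)
      hφ.continuous.continuousOn (fun x _ => (hφ₁ x).differentiableAt.differentiableWithinAt)
    have hξle : deriv φ ξ ≤ B := by
      rw [hslope, add_sub_cancel_left, div_one]
      linarith [hφ0 z, hφB (z + 1)]
    have hF : ∀ y, HasDerivAt (fun y => Real.exp (-c * y) * deriv φ y)
        (-c * Real.exp (-c * y) * deriv φ y + Real.exp (-c * y) * deriv (deriv φ) y) y :=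
      fun y => (hasDerivAt_exp_mul (-c) y).fun_mul (hφ₂ y)
    obtain ⟨ζ, hζ, hslope'⟩ := exists_hasDerivAt_eq_slope _ _ hξ.1
      (fun y _ => (hF y).continuousAt.continuousWithinAt) (fun y _ => hF y)
    rw [eq_div_iff (by linarith [hξ.1])] at hslope'
    have hexpz := Real.exp_pos (-c * z)
    have hζexp : Real.exp (-c * ζ) ≤ Real.exp (-c * z) := Real.exp_le_exp.2 (by nlinarith [hζ.1])
    have hξexp : Real.exp (-c * ξ) ≤ Real.exp (-c * z) := Real.exp_le_exp.2 (by nlinarith [hξ.1])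
    have hderiv : -(B * Real.exp (-c * z)) ≤
        -c * Real.exp (-c * ζ) * deriv φ ζ + Real.exp (-c * ζ) * deriv (deriv φ) ζ := by
      have h₁ : -B ≤ deriv (deriv φ) ζ - c * deriv φ ζ := by
        linarith [hprofile ζ, hφ0 ζ, hgB (ζ - c * h)]
      have h₂ := mul_le_mul_of_nonneg_left h₁ (Real.exp_pos (-c * ζ)).le
      have h₃ := mul_le_mul_of_nonneg_left hζexp hB
      linarith
    have hlen : 0 < ξ - z ∧ ξ - z ≤ 1 := ⟨by linarith [hξ.1], by linarith [hξ.2]⟩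
    have hBe : 0 ≤ B * Real.exp (-c * z) := by positivity
    have h₄ := mul_le_mul_of_nonneg_right hderiv hlen.1.le
    have h₅ := mul_le_mul_of_nonneg_left hlen.2 hBe
    have h₆ : Real.exp (-c * ξ) * deriv φ ξ ≤ Real.exp (-c * z) * B :=
      mul_le_mul hξexp hξle hφmono.deriv_nonneg hexpz.le
    have h₇ : Real.exp (-c * z) * deriv φ z ≤ Real.exp (-c * z) * (2 * B) := by
      linarith
    exact le_of_mul_le_mul_left h₇ hexpz
  have := Convex.norm_image_sub_le_of_norm_deriv_le (f := φ) (C := 2 * B) (s := Set.univ)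
    (x := y) (y := x) (fun z _ => (hφ₁ z).differentiableAt)
    (fun z _ => by
      rw [Real.norm_eq_abs, abs_of_nonneg hφmono.deriv_nonneg]
      exact hbound z) convex_univ trivial trivial
  simpa only [Real.norm_eq_abs] using this

namespace HypH

variable {g : ℝ → ℝ} {kap del0 Lg : ℝ}

theorem map_zero (hH : HypH g kap del0 Lg) : g 0 = 0 :=
  (hH.fixed_points 0 le_rfl).2 (Or.inl rfl)

theorem map_kap (hH : HypH g kap del0 Lg) : g kap = kap :=
  (hH.fixed_points kap hH.kap_pos.le).2 (Or.inr rfl)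

theorem differentiableAt (hH : HypH g kap del0 Lg) {x : ℝ} (hx : x ∈ Set.Ioo (-del0) del0) :
    DifferentiableAt ℝ g x :=
  (hH.smooth0.differentiableOn (by norm_num)).differentiableAt (Ioo_mem_nhds hx.1 hx.2)

theorem add_sub_le (hH : HypH g kap del0 Lg) (u r : ℝ) (hr : 0 ≤ r) :
    g (u + r) - g u ≤ max Lg (deriv g 0) * r := by
  have hpos : ∀ x ≥ 0, ∀ y ≥ x, g y - g x ≤ max Lg (deriv g 0) * (y - x) := by
    intro x hx y hy
    have h₁ := (le_abs_self _).trans (hH.lipschitz y x (hx.trans hy) hx)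
    rw [abs_of_nonneg (by linarith)] at h₁
    exact h₁.trans (mul_le_mul_of_nonneg_right (le_max_left _ _) (by linarith))
  have hneg : ∀ x, ∀ y ≥ x, y ≤ 0 → g y - g x ≤ max Lg (deriv g 0) * (y - x) := by
    intro x y hxy hy
    rw [hH.ext_linear y hy, hH.ext_linear x (hxy.trans hy), ← mul_sub]
    exact mul_le_mul_of_nonneg_right (le_max_right _ _) (by linarith)
  rcases le_total 0 u with hu | hu
  · simpa using hpos u hu (u + r) (by linarith)
  · rcases le_total (u + r) 0 with hur | hur
    · simpa using hneg u (u + r) (by linarith) hur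
    · linarith [hpos 0 le_rfl (u + r) hur, hneg u 0 hu le_rfl]

theorem exists_increment_bound (hH : HypH g kap del0 Lg) :
    ∃ C > (0 : ℝ), ∃ θ > (0 : ℝ), ∀ u v : ℝ, -del0 < u → u ≤ v → 0 < v → v < del0 →
      g v - g u ≤ (deriv g 0 + C * v ^ θ) * (v - u) := by
  obtain ⟨C, hC, θ, hθ, hhold⟩ := hH.holder
  refine ⟨C, hC, θ, hθ.1, fun u v hu huv hv hvd => ?_⟩
  rcases huv.eq_or_lt with rfl | huv
  · simp
  have hdiff : ∀ x ∈ Set.Icc u v, DifferentiableAt ℝ g x := fun x hx =>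
    hH.differentiableAt ⟨hu.trans_le hx.1, hx.2.trans_lt hvd⟩
  obtain ⟨x, hx, hslope⟩ := exists_deriv_eq_slope g huv
    (fun x hx => (hdiff x hx).continuousAt.continuousWithinAt)
    (fun x hx => (hdiff x ⟨hx.1.le, hx.2.le⟩).differentiableWithinAt)
  rw [eq_div_iff (by linarith)] at hslope
  rw [← hslope]
  refine mul_le_mul_of_nonneg_right ?_ (by linarith)
  have hvθ : 0 ≤ C * v ^ θ := by positivity
  rcases lt_trichotomy x 0 with hx0 | rfl | hx0
  · have heq : g =ᶠ[nhds x] fun y => deriv g 0 * y := by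
      filter_upwards [Iio_mem_nhds hx0] with y hy using hH.ext_linear y (le_of_lt hy)
    have : deriv g x = deriv g 0 := by
      rw [heq.deriv_eq]
      simp
    linarith
  · linarith
  · have h₁ := (le_abs_self _).trans (hhold x ⟨hx0, (hx.2.trans hvd).le⟩)
    have h₂ : C * x ^ θ ≤ C * v ^ θ := by
      have := hx.2.le
      have := hθ.1.le
      gcongr
    linarith

theorem exists_linear_lower_bound (hH : HypH g kap del0 Lg) :
    ∃ a > 0, ∃ u₀ > 0, ∀ u ∈ Set.Icc 0 u₀, (1 + a) * u ≤ g u := by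
  have h1 := hH.deriv0_gt
  have hd := hH.del0_pos
  refine ⟨(deriv g 0 - 1) / 2, by linarith, ?_⟩
  have hderiv := (hH.differentiableAt (x := 0) ⟨by linarith, hd⟩).hasDerivAt
  have hslope := (hasDerivWithinAt_iff_tendsto_slope' self_notMem_Ioi).1
    (hderiv.hasDerivWithinAt (s := Set.Ioi 0))
  have hev := hslope.eventually_const_lt (show 1 + (deriv g 0 - 1) / 2 < deriv g 0 by linarith)
  obtain ⟨u₀, hu₀, hsub⟩ := mem_nhdsGT_iff_exists_Ioc_subset.1 hev
  refine ⟨u₀, hu₀, fun u hu => ?_⟩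
  rcases hu.1.eq_or_lt with rfl | hupos
  · simp [hH.map_zero]
  · have h₁ : 1 + (deriv g 0 - 1) / 2 < slope g 0 u := hsub ⟨hupos, hu.2⟩
    rw [slope_def_field, hH.map_zero, sub_zero, sub_zero, lt_div_iff₀ hupos] at h₁
    exact h₁.le

end HypH

theorem IsWavefront.exists_exp_bound {g φ : ℝ → ℝ} {kap del0 Lg h c : ℝ}
    (hφ : IsWavefront g h c kap φ) (hH : HypH g kap del0 Lg) (hh : 0 < h) (hc : 0 < c)
    (hmono : Monotone φ) :
    ∃ A > 0, ∃ μ > 0, ∃ Z, ∀ z ≤ Z, φ z ≤ A * Real.exp (μ * z) := by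
  obtain ⟨hpos, -, hsmooth, hprofile, hbot, -⟩ := hφ
  obtain ⟨a, ha, u₀, hu₀, hg⟩ := hH.exists_linear_lower_bound
  obtain ⟨Z, hZ⟩ := (hbot.eventually_lt_const hu₀).exists
  obtain ⟨T, hT, hhalf⟩ :=
    exists_half_shift hh hc ha hH.cont hg hsmooth hpos hmono hprofile hZ.le
  obtain ⟨A, hA, μ, hμ, hbound⟩ := exists_exp_bound_of_half_shift hT hpos hmono hhalf
  exact ⟨A, hA, μ, hμ, Z, hbound⟩

/-- **Corollary `coco` (uniform local stability in the `|·|_{λ₁}` norm).**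
For every `ε > 0` there is `ς(ε) > 0` such that
`|φ(·) − w(s,·)|_{λ₁} < ς(ε)` for `s ∈ [−h,0]` implies `|φ(·) − w(t,·)|_{λ₁} < ε`
for all `t ≥ 0`.  (Strict weighted sup-norm bounds `|f|_{λ₁} < β` are rendered as
`∃ q < β` with `|f| ≤ q·η_{λ₁}` pointwise.) -/
theorem uniform_local_stability
    (g : ℝ → ℝ) (kap del0 Lg h c : ℝ)
    (hH : HypH g kap del0 Lg) (hmono : StrictMono g)
    (hh : 0 < h) (hc : 0 < c)
    (lam1 lam2 : ℝ) (hlam1_pos : 0 < lam1) (hlam_lt : lam1 < lam2)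
    (hchi1 : chi (deriv g 0) c h lam1 = 0) (hchi2 : chi (deriv g 0) c h lam2 = 0)
    (φ : ℝ → ℝ) (hφ : IsWavefront g h c kap φ) (hφinc : StrictMono φ)
    (qstar qlow dstar gstar : ℝ)
    (hqstar : 0 < qstar) (hqlow : qlow ∈ Set.Ioo 0 kap)
    (hdstar : dstar ∈ Set.Ioo (0:ℝ) del0) (hgstar : 0 < gstar)
    (hGG1 : GG1 g kap h dstar qlow gstar)
    (hGG2 : GG2 g kap h dstar qstar gstar)
    (b : ℝ) (hb : 0 < b) (hbφ : φ (b - c * h) = kap - dstar / 2)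
    -- inf_{z ≤ b} φ'(z)/η₁(z) > 0
    (hd : ∃ d > (0:ℝ), ∀ z ≤ b, d ≤ deriv φ z / eta lam1 z) :
    ∀ ε > (0:ℝ), ∃ ς > (0:ℝ), ∀ w0 : ℝ → ℝ → ℝ,
      (∀ s ∈ Set.Icc (-h) 0, ∀ z : ℝ, 0 ≤ w0 s z) →
      (∃ M : ℝ, ∀ s ∈ Set.Icc (-h) 0, ∀ z : ℝ, w0 s z ≤ M) →
      (∀ s ∈ Set.Icc (-h) 0, ∃ q < ς, ∀ z : ℝ, |φ z - w0 s z| ≤ q * eta lam1 z) →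
      ∀ w : ℝ → ℝ → ℝ, SolvesE1 g h c w →
        (∀ s ∈ Set.Icc (-h) 0, ∀ z : ℝ, w s z = w0 s z) →
        ∀ t ≥ (0:ℝ), ∃ q < ε, ∀ z : ℝ, |φ z - w t z| ≤ q * eta lam1 z := by
  obtain ⟨d, hd, hdφ⟩ := hd
  obtain ⟨hφpos, -, hφsmooth, hprofile, -, htop⟩ := id hφ
  have hkap := hH.kap_pos
  have hφkap : ∀ z, φ z ≤ kap := fun z => hφinc.monotone.ge_of_tendsto htop z
  have hgφ : ∀ z, g (φ z) ≤ kap := fun z =>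
    (hmono.monotone (hφkap z)).trans hH.map_kap.le
  have hlip := abs_sub_le_of_profile hc hφsmooth (fun z => (hφpos z).le) hφkap hφinc.monotone hgφ
    hprofile
  have hφabs : ∀ z, |φ z| ≤ kap := fun z => (abs_of_pos (hφpos z)).le.trans (hφkap z)
  have hφ'nonneg : ∀ z, 0 ≤ deriv φ z := fun z => hφinc.monotone.deriv_nonneg
  have hφ' : ∀ z ≤ b, d * eta lam1 z ≤ deriv φ z := fun z hz =>
    (le_div_iff₀ (eta_pos _ _)).1 (hdφ z hz)
  have hg0 : 0 < deriv g 0 := one_pos.trans hH.deriv0_gt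
  set L := max Lg (deriv g 0) with hL
  have hLpos : 0 < L := hg0.trans_le (le_max_right _ _)
  obtain ⟨C, hC, θ, hθ, hincr⟩ := hH.exists_increment_bound
  obtain ⟨A, hA, μ, hμ, Z₀, hdecay⟩ := hφ.exists_exp_bound hH hh hc hφinc.monotone
  obtain ⟨lam', hlam', Z, hZ, hsuper⟩ := exists_linear_tail_supersolution hh hc hlam1_pos hlam_lt
    hg0.le hC hθ hH.del0_pos hA hμ hchi1 hchi2 hincr hdecay
  have hnear : ∀ x > b, φ (x - c * h) ∈ Set.Icc (kap - dstar) kap := fun x hx =>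
    ⟨by linarith [hφinc (show b - c * h < x - c * h by linarith), hdstar.1], hφkap _⟩
  set α : ℝ := (L * Real.exp (gstar * h) + gstar + lam1 ^ 2)
    / (gstar * d * Real.exp (-(lam1 * b))) with hα
  have hαpos : 0 < α := by positivity
  have hαγ : L * Real.exp (gstar * h) + gstar + lam1 ^ 2 ≤
      α * gstar * d * Real.exp (-(lam1 * b)) := by
    rw [mul_assoc, mul_assoc, ← mul_assoc gstar, hα, div_mul_cancel₀ _ (by positivity)]
  intro ε hε
  set δ : ℝ := min 1 (ε / 4) with hδ
  have hδpos : 0 < δ := lt_min one_pos (by linarith)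
  have hδε : 2 * δ < ε := by linarith [min_le_right 1 (ε / 4)]
  set K : ℝ := 2 * kap * (α * Real.exp (gstar * h)) + 1 with hK
  have hKpos : 0 < K := by positivity
  set q : ℝ := min (min qstar qlow)
    (min (b / (α * Real.exp (gstar * h))) (min (δ * Real.exp (lam1 * Z) / K) δ)) with hq
  have hqpos : 0 < q := by
    have := hqlow.1
    refine lt_min (lt_min hqstar this) (lt_min ?_ (lt_min ?_ hδpos)) <;> positivity
  have hqmax : q ≤ min qstar qlow := min_le_left _ _
  have hqb : α * q * Real.exp (gstar * h) ≤ b := by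
    have : q ≤ b / (α * Real.exp (gstar * h)) := (min_le_right _ _).trans (min_le_left _ _)
    rw [le_div_iff₀ (by positivity)] at this
    linarith
  have hqZ : q * K ≤ δ * Real.exp (lam1 * Z) := by
    have : q ≤ δ * Real.exp (lam1 * Z) / K :=
      (min_le_right _ _).trans ((min_le_right _ _).trans (min_le_left _ _))
    rwa [le_div_iff₀ hKpos] at this
  have hqδ : q ≤ δ := (min_le_right _ _).trans ((min_le_right _ _).trans (min_le_right _ _))
  refine ⟨q, hqpos, fun w0 _ _ hclose w hw hww0 t ht => ⟨2 * δ, hδε, fun z => ?_⟩⟩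
  have hinit : ∀ s ∈ Set.Icc (-h) 0, ∀ z, |φ z - w s z| ≤ q * eta lam1 z := by
    intro s hs z
    obtain ⟨q', hq', hbound⟩ := hclose s hs
    rw [hww0 s hs z]
    exact (hbound z).trans (mul_le_mul_of_nonneg_right hq'.le (eta_pos _ _).le)
  have hψpos : ∀ x : ℝ, 0 < δ * (Real.exp (lam1 * x) + Real.exp (lam' * x)) := fun x => by
    positivity
  have hupper : w t z ≤ φ z + 2 * δ * eta lam1 z := by
    refine solution_le_add_eta (G := g) (Φ := φ) (σ := 1) hh hc hlam1_pos hlam'.le hb hd hLpos.le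
      hgstar hαpos hqpos hqmax abs_one hδpos hZ hmono.monotone hH.add_sub_le hφsmooth hφabs hlip
      hprofile (fun z s s' hs => hφinc.monotone (by linarith)) (by simpa using hφ'nonneg)
      (by simpa using hφ') ?_ hαγ hqb hqZ hqδ ?_ hw ?_ t ht z
    · intro x hx Q hQ
      have := hGG2 _ (hnear x hx) Q ⟨hQ.1, hQ.2.trans (min_le_left _ _)⟩ gstar ⟨hgstar.le, le_rfl⟩
      linarith
    · intro z hz
      have h₁ := hψpos (z - c * h)
      have h₂ := hφpos (z - c * h)
      exact hsuper δ ⟨hδpos, min_le_left _ _⟩ z hz _ _ _ rfl (by linarith) rfl (by linarith) le_rfl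
    · intro s hs z
      linarith [(abs_le.1 (hinit s hs z)).1]
  have hlower : -w t z ≤ -φ z + 2 * δ * eta lam1 z := by
    refine solution_le_add_eta (G := fun u => -g (-u)) (Φ := fun z => -φ z) (σ := -1)
      (W := fun t z => -w t z) hh hc hlam1_pos hlam'.le hb hd hLpos.le hgstar hαpos hqpos hqmax
      (by simp) hδpos hZ (fun u v huv => neg_le_neg (hmono.monotone (neg_le_neg huv))) ?_
      hφsmooth.neg (fun z => (abs_neg _).trans_le (hφabs z)) ?_ ?_
      (fun z s s' hs => neg_le_neg (hφinc.monotone (by linarith)))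
      (by simpa [deriv.fun_neg'] using hφ'nonneg) (by simpa [deriv.fun_neg'] using hφ') ?_ hαγ hqb
      hqZ hqδ ?_ hw.reflect ?_ t ht z
    · intro u r hr
      have := hH.add_sub_le (-u - r) r hr
      rw [sub_add_cancel] at this
      rw [neg_add']
      linarith
    · intro x y
      rw [neg_sub_neg, abs_sub_comm]
      exact hlip x y
    · intro z
      simp only [deriv.fun_neg', neg_neg]
      linarith [hprofile z]
    · intro x hx Q hQ
      have := hGG1 _ (hnear x hx) Q ⟨hQ.1, hQ.2.trans (min_le_right _ _)⟩ gstar ⟨hgstar.le, le_rfl⟩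
      simp only [neg_add', neg_neg]
      linarith
    · intro z hz
      have h₁ := hψpos (z - c * h)
      have h₂ := hφpos (z - c * h)
      have := hsuper δ ⟨hδpos, min_le_left _ _⟩ z hz
        (φ (z - c * h) - δ * (Real.exp (lam1 * (z - c * h)) + Real.exp (lam' * (z - c * h))))
        (φ (z - c * h)) _ rfl (by linarith) (by ring) h₂ (by linarith)
      simp only [neg_add', neg_neg]
      linarith
    · intro s hs z
      linarith [(abs_le.1 (hinit s hs z)).2]
  exact abs_le.2 ⟨by linarith, by linarith⟩
end
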